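/- Let L > 0 and let p denote the Neumann heat kernel on [0,L]. Then for every ε > 0 there exists a positive finite constant K = K(ε, L) such that for all β ≥ K, sup_{t ≥ 0} sup_{0 ≤ x ≤ L} ∫₀ᵗ e^{−βs} p_{2s}(x,x) ds ≤ (3 + ε)/√(8β). -/

import Mathlib

open MeasureTheory Real

/-- The Gaussian heat kernel on `ℝ`: `Γ_t(z) = (4πt)^{-1/2} exp(-z²/(4t))`. -/
noncomputable def heatGauss (t z : ℝ) : ℝ :=
  Real.exp (-z ^ 2 / (4 * t)) / Real.sqrt (4 * π * t)

/-- The Neumann heat kernel on `[0, L]`, obtained by the method of images: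
`p_t(x,y) = ∑_{n ∈ ℤ} [Γ_t(x-y-2nL) + Γ_t(x+y-2nL)]`. -/
noncomputable def neumannHeatKernel (L t x y : ℝ) : ℝ :=
  ∑' n : ℤ, (heatGauss t (x - y - 2 * (n : ℝ) * L) + heatGauss t (x + y - 2 * (n : ℝ) * L))

theorem heatGauss_nonneg (t z : ℝ) : 0 ≤ heatGauss t z := by
  unfold heatGauss; positivity

/-- The Gaussian factor is dominated by its argument's inverse square. -/
theorem exp_neg_sq_div_le {t z w : ℝ} (ht : 0 < t) (hw : 0 < w) (h : 4 * w ≤ z ^ 2) :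
    Real.exp (-z ^ 2 / (4 * t)) ≤ t / w := by
  have hle : w / t ≤ z ^ 2 / (4 * t) := by
    rw [div_le_div_iff₀ ht (by positivity)]
    nlinarith
  have hexp : w / t ≤ Real.exp (z ^ 2 / (4 * t)) := by
    linarith [Real.add_one_le_exp (z ^ 2 / (4 * t))]
  rw [neg_div, Real.exp_neg, ← inv_div w t]
  exact inv_anti₀ (by positivity) hexp

theorem exp_neg_sq_div_le_one {t : ℝ} (ht : 0 < t) (z : ℝ) :
    Real.exp (-z ^ 2 / (4 * t)) ≤ 1 := by
  rw [Real.exp_le_one_iff, neg_div, neg_nonpos]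
  positivity

theorem exp_direct_image_le {L t : ℝ} (hL : 0 < L) (ht : 0 < t) (x : ℝ) (n : ℤ) :
    Real.exp (-(x - x - 2 * (n : ℝ) * L) ^ 2 / (4 * t))
      ≤ (if n = 0 then 1 else 0) + t / L ^ 2 * (1 / (n : ℝ) ^ 2) := by
  rcases eq_or_ne n 0 with rfl | hn
  · simp
  · have hn' : (n : ℝ) ≠ 0 := by exact_mod_cast hn
    have := exp_neg_sq_div_le (z := x - x - 2 * (n : ℝ) * L) (w := L ^ 2 * (n : ℝ) ^ 2) ht
      (by positivity) (by nlinarith)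
    rw [if_neg hn, zero_add, div_mul_div_comm, mul_one]
    exact this

theorem exp_reflected_image_le {L t x : ℝ} (hL : 0 < L) (ht : 0 < t)
    (hx : x ∈ Set.Icc (0 : ℝ) L) (n : ℤ) :
    Real.exp (-(x + x - 2 * (n : ℝ) * L) ^ 2 / (4 * t))
      ≤ (if n = 0 then 1 else 0) + (if n = 1 then 1 else 0)
        + t / L ^ 2 * (1 / (n : ℝ) ^ 2 + 1 / ((n - 1 : ℤ) : ℝ) ^ 2) := by
  obtain ⟨hx0, hxL⟩ := hx
  have hrest : 0 ≤ t / L ^ 2 * (1 / (n : ℝ) ^ 2 + 1 / ((n - 1 : ℤ) : ℝ) ^ 2) := by positivity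
  have hone := exp_neg_sq_div_le_one ht (x + x - 2 * (n : ℝ) * L)
  rcases eq_or_ne n 0 with h0 | h0
  · rw [if_pos h0, if_neg (by omega)]
    linarith
  rcases eq_or_ne n 1 with h1 | h1
  · rw [if_neg h0, if_pos h1]
    linarith
  rw [if_neg h0, if_neg h1, add_zero, zero_add, mul_add, div_mul_div_comm, div_mul_div_comm,
    mul_one]
  rcases lt_or_gt_of_ne h0 with hneg | hpos
  · have hn : (n : ℝ) < 0 := by exact_mod_cast hneg
    have hnL : 0 < -(n : ℝ) * L := mul_pos (by linarith) hL
    have := exp_neg_sq_div_le (z := x + x - 2 * (n : ℝ) * L) (w := L ^ 2 * (n : ℝ) ^ 2) ht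
      (by rw [← mul_pow]; nlinarith) (by nlinarith [mul_nonneg hx0 hnL.le, sq_nonneg x])
    exact this.trans (le_add_of_nonneg_right (by positivity))
  · have hn : (0 : ℝ) < ((n - 1 : ℤ) : ℝ) := by exact_mod_cast (by omega : (0 : ℤ) < n - 1)
    have hnL : 0 < ((n - 1 : ℤ) : ℝ) * L := mul_pos hn hL
    have hz : x + x - 2 * (n : ℝ) * L = -2 * ((L - x) + ((n - 1 : ℤ) : ℝ) * L) := by
      push_cast; ring
    have := exp_neg_sq_div_le (z := x + x - 2 * (n : ℝ) * L)
      (w := L ^ 2 * ((n - 1 : ℤ) : ℝ) ^ 2) ht (by positivity)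
      (by rw [hz]; nlinarith [mul_nonneg (sub_nonneg.2 hxL) hnL.le, sq_nonneg (L - x)])
    exact this.trans (le_add_of_nonneg_left (by positivity))

/-- On the diagonal the Neumann kernel is at most `3 + O(t)` times the Gaussian peak. -/
theorem exists_neumannHeatKernel_diag_le {L : ℝ} (hL : 0 < L) :
    ∃ C : ℝ, 0 ≤ C ∧ ∀ t : ℝ, 0 < t → ∀ x ∈ Set.Icc (0 : ℝ) L,
      neumannHeatKernel L t x x ≤ (3 + C * t) / Real.sqrt (4 * π * t) := by
  have hS : Summable fun n : ℤ => 1 / (n : ℝ) ^ 2 :=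
    Real.summable_one_div_int_pow.2 (by norm_num)
  have hS' : Summable fun n : ℤ => 1 / ((n - 1 : ℤ) : ℝ) ^ 2 :=
    hS.comp_injective (i := fun n : ℤ => n - 1) sub_left_injective
  obtain ⟨A, hA⟩ := hS
  obtain ⟨B, hB⟩ := hS'
  have hδ (k : ℤ) : HasSum (fun n : ℤ => if n = k then (1 : ℝ) else 0) 1 := hasSum_ite_eq k 1
  have hA0 : 0 ≤ A := hA.nonneg fun n => by positivity
  have hB0 : 0 ≤ B := hB.nonneg fun n => by positivity
  refine ⟨(2 * A + B) / L ^ 2, by positivity, fun t ht x hx => ?_⟩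
  have hsum := (((hδ 0).add (hA.mul_left (t / L ^ 2))).add
    (((hδ 0).add (hδ 1)).add ((hA.add hB).mul_left (t / L ^ 2)))).div_const
      (Real.sqrt (4 * π * t))
  have hle (n : ℤ) := div_le_div_of_nonneg_right
    (add_le_add (exp_direct_image_le hL ht x n) (exp_reflected_image_le hL ht hx n))
    (Real.sqrt_nonneg (4 * π * t))
  simp only [add_div (Real.exp _)] at hle
  have hsummable := Summable.of_nonneg_of_le
    (fun n => add_nonneg (heatGauss_nonneg _ _) (heatGauss_nonneg _ _)) hle hsum.summable
  unfold neumannHeatKernel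
  refine (hasSum_le hle hsummable.hasSum hsum).trans_eq ?_
  congr 1
  ring

/-- The Laplace transform of `(3 + c s) / √(8πs)`. -/
theorem laplace_affine_div_sqrt (c : ℝ) {β : ℝ} (hβ : 0 < β) :
    IntegrableOn (fun s => Real.exp (-β * s) * ((3 + c * s) / Real.sqrt (8 * π * s)))
      (Set.Ioi 0) ∧
    ∫ s in Set.Ioi (0 : ℝ), Real.exp (-β * s) * ((3 + c * s) / Real.sqrt (8 * π * s))
      = (3 + c / (2 * β)) / Real.sqrt (8 * β) := by
  have hint (a : ℝ) (ha : -1 < a) :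
      IntegrableOn (fun s : ℝ => s ^ a * Real.exp (-(β * s))) (Set.Ioi 0) := by
    simpa [neg_mul] using integrableOn_rpow_mul_exp_neg_mul_rpow (p := 1) (s := a) ha one_pos hβ
  have hEq : Set.EqOn
      (fun s => Real.exp (-β * s) * ((3 + c * s) / Real.sqrt (8 * π * s)))
      (fun s => 3 / Real.sqrt (8 * π) * (s ^ ((1 / 2 : ℝ) - 1) * Real.exp (-(β * s)))
        + c / Real.sqrt (8 * π) * (s ^ ((3 / 2 : ℝ) - 1) * Real.exp (-(β * s)))) (Set.Ioi 0) := by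
    intro s hs
    have hs : 0 < s := hs
    have h1 : s ^ ((1 / 2 : ℝ) - 1) = 1 / Real.sqrt s := by
      rw [Real.rpow_sub_one hs.ne', ← Real.sqrt_eq_rpow, ← Real.sqrt_div_self']
    have h2 : s ^ ((3 / 2 : ℝ) - 1) = s / Real.sqrt s := by
      rw [Real.div_sqrt, Real.sqrt_eq_rpow]; norm_num
    simp only
    rw [h1, h2, Real.sqrt_mul (by positivity), neg_mul]
    have := Real.sqrt_pos.2 hs
    field_simp
  have hi1 := (hint ((1 / 2 : ℝ) - 1) (by norm_num)).const_mul (3 / Real.sqrt (8 * π))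
  have hi2 := (hint ((3 / 2 : ℝ) - 1) (by norm_num)).const_mul (c / Real.sqrt (8 * π))
  refine ⟨(integrableOn_congr_fun hEq measurableSet_Ioi).2 (hi1.add hi2), ?_⟩
  rw [setIntegral_congr_fun measurableSet_Ioi hEq, integral_add hi1 hi2, integral_const_mul,
    integral_const_mul, Real.integral_rpow_mul_exp_neg_mul_Ioi (by norm_num) hβ,
    Real.integral_rpow_mul_exp_neg_mul_Ioi (by norm_num) hβ,
    show (3 / 2 : ℝ) = 1 / 2 + 1 by norm_num, Real.Gamma_add_one (by norm_num),
    Real.Gamma_one_half_eq, Real.rpow_add_one (by positivity), ← Real.sqrt_eq_rpow,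
    Real.sqrt_div zero_le_one, Real.sqrt_one, Real.sqrt_mul (by norm_num) π,
    Real.sqrt_mul (by norm_num) β]
  have := Real.sqrt_pos.2 hβ
  have := Real.sqrt_pos.2 Real.pi_pos
  field_simp

theorem neumann_diag_laplace_transform_bound
    (L : ℝ) (hL : 0 < L) (ε : ℝ) (hε : 0 < ε) :
    ∃ K : ℝ, 0 < K ∧ ∀ β : ℝ, K ≤ β →
      ∀ t : ℝ, 0 ≤ t → ∀ x ∈ Set.Icc (0 : ℝ) L,
        (∫ s in (0 : ℝ)..t, Real.exp (-β * s) * neumannHeatKernel L (2 * s) x x)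
          ≤ (3 + ε) / Real.sqrt (8 * β) := by
  obtain ⟨C, hC, hker⟩ := exists_neumannHeatKernel_diag_le hL
  refine ⟨C / ε + 1, by positivity, fun β hβ t ht x hx => ?_⟩
  have hβ0 : 0 < β := lt_of_lt_of_le (by positivity) hβ
  obtain ⟨hint, hval⟩ := laplace_affine_div_sqrt (2 * C) hβ0
  rw [intervalIntegral.integral_of_le ht]
  calc _ ≤ ∫ s in Set.Ioc 0 t,
          Real.exp (-β * s) * ((3 + 2 * C * s) / Real.sqrt (8 * π * s)) := by
        refine integral_mono_of_nonneg (.of_forall fun s => ?_)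
          (hint.mono_set Set.Ioc_subset_Ioi_self) ?_
        · exact mul_nonneg (Real.exp_nonneg _)
            (tsum_nonneg fun n => add_nonneg (heatGauss_nonneg _ _) (heatGauss_nonneg _ _))
        · filter_upwards [ae_restrict_mem measurableSet_Ioc] with s hs
          have := hker (2 * s) (by linarith [hs.1]) x hx
          rw [show C * (2 * s) = 2 * C * s by ring,
            show 4 * π * (2 * s) = 8 * π * s by ring] at this
          exact mul_le_mul_of_nonneg_left this (Real.exp_nonneg _)
    _ ≤ ∫ s in Set.Ioi 0,
          Real.exp (-β * s) * ((3 + 2 * C * s) / Real.sqrt (8 * π * s)) := by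
        refine setIntegral_mono_set hint ?_ Set.Ioc_subset_Ioi_self.eventuallyLE
        filter_upwards [ae_restrict_mem measurableSet_Ioi] with s hs
        have hs : 0 < s := hs
        exact mul_nonneg (Real.exp_nonneg _) (by positivity)
    _ = (3 + 2 * C / (2 * β)) / Real.sqrt (8 * β) := hval
    _ ≤ (3 + ε) / Real.sqrt (8 * β) := by
        have : 2 * C / (2 * β) ≤ ε := by
          rw [mul_div_mul_left _ _ two_ne_zero, div_le_iff₀ hβ0]
          have := (div_le_iff₀ hε).1 (show C / ε ≤ β by linarith)
          linarith
        gcongr
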